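/- arXiv:2012.09739 — 3 statements merged into one kernel-verified Lean document; each statement's English description precedes it below -/
import Mathlib

section
/- Let z be a real random variable whose law has Lebesgue density f, fix y ∈ ℝ and ς > 0, and define the rounding map R on [y−ς, y+ς] by R(w) = y−ς if w ∈ [y−ς, y) and R(w) = y+ς if w ∈ [y, y+ς]. Then E( (R(z) − z)·1_{z ∈ [y−ς, y+ς]} ) = ∫_0^ς (ς − u)·( f(y+u) − f(y−u) ) du. -/
open MeasureTheory

/-- The density of a finite law is integrable. -/
theorem integrable_of_withDensity_ofReal_finite {α : Type*} [MeasurableSpace α] {ν : Measure α}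
    {f : α → ℝ} (hf_meas : Measurable f) (hf_nonneg : ∀ x, 0 ≤ f x)
    [IsFiniteMeasure (ν.withDensity fun x => ENNReal.ofReal (f x))] : Integrable f ν := by
  refine ⟨hf_meas.aestronglyMeasurable, ?_⟩
  rw [hasFiniteIntegral_iff_ofReal (Filter.Eventually.of_forall hf_nonneg)]
  have h := measure_lt_top (ν.withDensity fun x => ENNReal.ofReal (f x)) Set.univ
  rwa [withDensity_apply _ MeasurableSet.univ, Measure.restrict_univ] at h

/-- The law of the unconscious statistician for a random variable with a density. -/
theorem integral_comp_eq_integral_mul_density {Ω α : Type*} [MeasurableSpace Ω]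
    [MeasurableSpace α] {μ : Measure Ω} {ν : Measure α} {z : Ω → α} (hz : Measurable z)
    {f : α → ℝ} (hf_meas : Measurable f) (hf_nonneg : ∀ x, 0 ≤ f x)
    (hlaw : Measure.map z μ = ν.withDensity fun x => ENNReal.ofReal (f x))
    {g : α → ℝ} (hg : Measurable g) : ∫ ω, g (z ω) ∂μ = ∫ x, g x * f x ∂ν := by
  rw [← integral_map hz.aemeasurable hg.aestronglyMeasurable, hlaw,
    integral_withDensity_eq_integral_toReal_smul hf_meas.ennreal_ofReal
      (Filter.Eventually.of_forall fun _ => ENNReal.ofReal_lt_top)]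
  refine integral_congr_ae (Filter.Eventually.of_forall fun x => ?_)
  simp [ENNReal.toReal_ofReal (hf_nonneg x), mul_comm]

/-- expected local rounding error as an integral against the density.
`z` has law with Lebesgue density `f`; on `[y−ς, y+ς]` the rounding map `R` sends
`[y−ς, y)` to `y−ς` and `[y, y+ς]` to `y+ς`.  Then
`E((R(z) − z)·1_{z ∈ [y−ς,y+ς]}) = ∫_0^ς (ς − u)(f(y+u) − f(y−u)) du`. -/
theorem stmt_7 {Ω : Type*} [MeasurableSpace Ω] (μ : Measure Ω) [IsProbabilityMeasure μ]
    (z : Ω → ℝ) (hz : Measurable z)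
    (f : ℝ → ℝ) (hf_meas : Measurable f) (hf_nonneg : ∀ x, 0 ≤ f x)
    (hlaw : Measure.map z μ = volume.withDensity (fun x => ENNReal.ofReal (f x)))
    (y ς : ℝ) (hς : 0 < ς)
    (R : ℝ → ℝ)
    (hR₁ : ∀ w ∈ Set.Ico (y - ς) y, R w = y - ς)
    (hR₂ : ∀ w ∈ Set.Icc y (y + ς), R w = y + ς) :
    ∫ ω, Set.indicator (Set.Icc (y - ς) (y + ς)) (fun w => R w - w) (z ω) ∂μ
      = ∫ u in (0 : ℝ)..ς, (ς - u) * (f (y + u) - f (y - u)) := by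
  have : IsFiniteMeasure (volume.withDensity fun x => ENNReal.ofReal (f x)) := by
    rw [← hlaw]; infer_instance
  have hf : Integrable f := integrable_of_withDensity_ofReal_finite hf_meas hf_nonneg
  set h : ℝ → ℝ := fun w => (if w < y then y - ς else y + ς) - w with h_def
  have hh : Measurable h :=
    (Measurable.ite measurableSet_Iio measurable_const measurable_const).sub measurable_id
  have hRh : Set.indicator (Set.Icc (y - ς) (y + ς)) (fun w => R w - w)
      = Set.indicator (Set.Icc (y - ς) (y + ς)) h := by
    refine Set.indicator_congr fun w hw => ?_
    rcases lt_or_ge w y with hwy | hwy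
    · simp [h_def, hwy, hR₁ w ⟨hw.1, hwy⟩]
    · simp [h_def, hwy.not_gt, hR₂ w ⟨hwy, hw.2⟩]
  have hmul (c : ℝ) (a b : ℝ) :
      IntervalIntegrable (fun x => (c - x) * f x) volume a b :=
    hf.intervalIntegrable.continuousOn_mul (by fun_prop)
  have hleft_ae : ∀ᵐ x, x ∈ Set.uIoc (y - ς) y → h x * f x = (y - ς - x) * f x := by
    filter_upwards [Measure.ae_ne volume y] with x hx hmem
    rw [Set.uIoc_of_le (by linarith)] at hmem
    simp [h_def, lt_of_le_of_ne hmem.2 hx]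
  have hright_ae : ∀ᵐ x, x ∈ Set.uIoc y (y + ς) → h x * f x = (y + ς - x) * f x := by
    refine Filter.Eventually.of_forall fun x hmem => ?_
    rw [Set.uIoc_of_le (by linarith)] at hmem
    simp [h_def, hmem.1.not_gt]
  have hleft_int : IntervalIntegrable (fun x => h x * f x) volume (y - ς) y :=
    (hmul (y - ς) _ _).congr_ae <| (ae_restrict_iff' measurableSet_uIoc).2 <|
      hleft_ae.mono fun x hx hm => (hx hm).symm
  have hright_int : IntervalIntegrable (fun x => h x * f x) volume y (y + ς) :=
    (hmul (y + ς) _ _).congr_ae <| (ae_restrict_iff' measurableSet_uIoc).2 <|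
      hright_ae.mono fun x hx hm => (hx hm).symm
  have hleft : ∫ x in (y - ς)..y, (y - ς - x) * f x
      = ∫ u in (0 : ℝ)..ς, (u - ς) * f (y - u) := by
    have := intervalIntegral.integral_comp_sub_left (a := 0) (b := ς)
      (fun x => (y - ς - x) * f x) y
    rw [sub_zero] at this
    rw [← this]
    refine intervalIntegral.integral_congr fun u _ => ?_
    ring_nf
  have hright : ∫ x in y..(y + ς), (y + ς - x) * f x
      = ∫ u in (0 : ℝ)..ς, (ς - u) * f (y + u) := by
    have := intervalIntegral.integral_comp_add_left (a := 0) (b := ς)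
      (fun x => (y + ς - x) * f x) y
    rw [add_zero] at this
    rw [← this]
    refine intervalIntegral.integral_congr fun u _ => ?_
    ring_nf
  have hsub_int : IntervalIntegrable (fun u => (u - ς) * f (y - u)) volume 0 ς :=
    (hf.comp_sub_left y).intervalIntegrable.continuousOn_mul (by fun_prop)
  have hadd_int : IntervalIntegrable (fun u => (ς - u) * f (y + u)) volume 0 ς :=
    (hf.comp_add_left y).intervalIntegrable.continuousOn_mul (by fun_prop)
  rw [hRh, integral_comp_eq_integral_mul_density hz hf_meas hf_nonneg hlaw
    (hh.indicator measurableSet_Icc)]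
  simp_rw [← Set.indicator_mul_left]
  rw [integral_indicator measurableSet_Icc, integral_Icc_eq_integral_Ioc,
    ← intervalIntegral.integral_of_le (by linarith),
    ← intervalIntegral.integral_add_adjacent_intervals hleft_int hright_int,
    intervalIntegral.integral_congr_ae hleft_ae, intervalIntegral.integral_congr_ae hright_ae,
    hleft, hright, ← intervalIntegral.integral_add hsub_int hadd_int]
  refine intervalIntegral.integral_congr fun u _ => ?_
  ring
end

section
/- Let y ∈ ℝ and ς > 0, and let f : ℝ → ℝ be differentiable on [y−ς, y+ς] with |f'(w)| ≤ D for all w ∈ [y−ς, y+ς]. Then | ∫_0^ς (ς − u)·( f(y+u) − f(y−u) ) du | ≤ (D·ς³)/3. -/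
/-- if `f` is differentiable on `[y−ς, y+ς]` with derivative bounded by `D`
there, then `|∫_0^ς (ς−u)(f(y+u) − f(y−u)) du| ≤ D ς³ / 3`. -/
theorem stmt_9 (y ς : ℝ) (hς : 0 < ς) (f : ℝ → ℝ) (D : ℝ)
    (hdiff : DifferentiableOn ℝ f (Set.Icc (y - ς) (y + ς)))
    (hD : ∀ w ∈ Set.Icc (y - ς) (y + ς),
      |derivWithin f (Set.Icc (y - ς) (y + ς)) w| ≤ D) :
    |∫ u in (0 : ℝ)..ς, (ς - u) * (f (y + u) - f (y - u))| ≤ D * ς ^ 3 / 3 := by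
  have hbound : ∀ u ∈ Set.Ioc 0 ς,
      ‖(ς - u) * (f (y + u) - f (y - u))‖ ≤ 2 * D * ς * u - 2 * D * u ^ 2 := by
    rintro u ⟨hu0, huς⟩
    have hmvt : ‖f (y + u) - f (y - u)‖ ≤ D * ‖(y + u) - (y - u)‖ :=
      (convex_Icc _ _).norm_image_sub_le_of_norm_derivWithin_le hdiff hD
        ⟨by linarith, by linarith⟩ ⟨by linarith, by linarith⟩
    rw [show (y + u) - (y - u) = 2 * u by ring, Real.norm_of_nonneg (by linarith : 0 ≤ 2 * u)]
      at hmvt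
    rw [norm_mul, Real.norm_of_nonneg (sub_nonneg.2 huς)]
    calc (ς - u) * ‖f (y + u) - f (y - u)‖ ≤ (ς - u) * (D * (2 * u)) :=
          mul_le_mul_of_nonneg_left hmvt (sub_nonneg.2 huς)
      _ = 2 * D * ς * u - 2 * D * u ^ 2 := by ring
  have hintegral : ∫ u in (0 : ℝ)..ς, (2 * D * ς * u - 2 * D * u ^ 2) = D * ς ^ 3 / 3 := by
    rw [intervalIntegral.integral_sub
      (Continuous.intervalIntegrable (by fun_prop) _ _)
      (Continuous.intervalIntegrable (by fun_prop) _ _),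
      intervalIntegral.integral_const_mul, intervalIntegral.integral_const_mul,
      integral_id, integral_pow]
    ring
  rw [← hintegral, ← Real.norm_eq_abs]
  exact intervalIntegral.norm_integral_le_of_norm_le hς.le (.of_forall hbound)
    (Continuous.intervalIntegrable (by fun_prop) _ _)
end

section
/- Let ς > 0 and let R_ς : ℝ → ℝ be rounding to the nearest point of the grid ς·ℤ, i.e. R_ς(w) = ς·n for w ∈ [ς·n − ς/2, ς·n + ς/2) (the choice of tie-breaking rule is immaterial since ties form a Lebesgue-null set). Let z be a real random variable whose law has a continuously differentiable Lebesgue density f with f' integrable on ℝ. Then | E( R_ς(z) − z ) | ≤ (ς²/8) · ∫_ℝ |f'(w)| dw. -/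
open MeasureTheory

/-- On a cell of length `ς` centred at `c`, the first moment of a `C¹` function about `c` is
at most `ς ^ 2 / 8` times the integral of the absolute value of its derivative. -/
theorem abs_setIntegral_Ico_center_sub_mul_le {f : ℝ → ℝ} (hf : ContDiff ℝ 1 f) {ς : ℝ}
    (hς : 0 < ς) (c : ℝ) :
    |∫ w in Set.Ico (c - ς / 2) (c + ς / 2), (c - w) * f w| ≤
      ς ^ 2 / 8 * ∫ w in Set.Ico (c - ς / 2) (c + ς / 2), |deriv f w| := by
  have hab : c - ς / 2 ≤ c + ς / 2 := by linarith
  have hdc : Continuous (deriv f) := hf.continuous_deriv le_rfl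
  rw [integral_Ico_eq_integral_Ioc, integral_Ico_eq_integral_Ioc,
    ← intervalIntegral.integral_of_le hab, ← intervalIntegral.integral_of_le hab]
  have hkernel : ∀ w, HasDerivAt (fun w => ς ^ 2 / 8 - (w - c) ^ 2 / 2) (c - w) w := by
    intro w
    have h := ((((hasDerivAt_id w).sub_const c).pow 2).div_const 2).const_sub (ς ^ 2 / 8)
    exact h.congr_deriv (by simp)
  have hparts := intervalIntegral.integral_deriv_mul_eq_sub (a := c - ς / 2) (b := c + ς / 2)
    (fun w _ => hkernel w)
    (fun w _ => ((hf.differentiable one_ne_zero) w).hasDerivAt)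
    (Continuous.intervalIntegrable (by fun_prop) _ _) (hdc.intervalIntegrable _ _)
  have hfc : Continuous f := hf.continuous
  rw [intervalIntegral.integral_add (Continuous.intervalIntegrable (by fun_prop) _ _)
    (Continuous.intervalIntegrable (by fun_prop) _ _)] at hparts
  have heq : ∫ w in (c - ς / 2)..(c + ς / 2), (c - w) * f w =
      -∫ w in (c - ς / 2)..(c + ς / 2), (ς ^ 2 / 8 - (w - c) ^ 2 / 2) * deriv f w := by
    rw [eq_neg_iff_add_eq_zero, hparts]
    ring
  rw [heq, abs_neg, ← intervalIntegral.integral_const_mul]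
  refine (intervalIntegral.abs_integral_le_integral_abs hab).trans
    (intervalIntegral.integral_mono_on hab (Continuous.intervalIntegrable (by fun_prop) _ _)
      (Continuous.intervalIntegrable (by fun_prop) _ _) fun w hw => ?_)
  rw [abs_mul]
  refine mul_le_mul_of_nonneg_right (abs_le.2 ⟨?_, ?_⟩) (abs_nonneg _)
  · nlinarith [hw.1, hw.2, mul_nonneg (sub_nonneg.2 hw.1) (sub_nonneg.2 hw.2)]
  · nlinarith [sq_nonneg (w - c)]

/-- mean rounding error under round-to-nearest onto the grid `ς·ℤ`.
If `z` has a C¹ Lebesgue density `f` with integrable derivative, and `R : ℝ → ℝ` rounds to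
the nearest grid point (`R w = ς·n` for `w ∈ [ς·n − ς/2, ς·n + ς/2)`; the tie-break choice
is immaterial since ties are null), then `|E(R(z) − z)| ≤ (ς²/8)·∫|f'|`. -/
theorem stmt_10 {Ω : Type*} [MeasurableSpace Ω] (μ : Measure Ω) [IsProbabilityMeasure μ]
    (ς : ℝ) (hς : 0 < ς) (z : Ω → ℝ) (hz : Measurable z)
    (f : ℝ → ℝ) (hf_nonneg : ∀ x, 0 ≤ f x) (hf_smooth : ContDiff ℝ 1 f)
    (hf' : Integrable (deriv f))
    (hlaw : Measure.map z μ = volume.withDensity (fun x => ENNReal.ofReal (f x)))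
    (R : ℝ → ℝ)
    (hR : ∀ n : ℤ, ∀ w ∈ Set.Ico (ς * n - ς / 2) (ς * n + ς / 2), R w = ς * n) :
    |∫ ω, (R (z ω) - z ω) ∂μ| ≤ ς ^ 2 / 8 * ∫ w, |deriv f w| := by
  have hfc : Continuous f := hf_smooth.continuous
  have hmem : ∀ w, w ∈ Set.Ico (ς * ⌊w / ς + 1 / 2⌋ - ς / 2) (ς * ⌊w / ς + 1 / 2⌋ + ς / 2) := by
    intro w
    have hw : ς * (w / ς) = w := mul_div_cancel₀ w hς.ne'
    constructor
    · nlinarith [mul_le_mul_of_nonneg_left (Int.floor_le (w / ς + 1 / 2)) hς.le]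
    · nlinarith [mul_lt_mul_of_pos_left (Int.lt_floor_add_one (w / ς + 1 / 2)) hς]
  have hRfloor : R = fun w => ς * (⌊w / ς + 1 / 2⌋ : ℝ) := funext fun w => hR _ w (hmem w)
  have hRm : Measurable R := by
    rw [hRfloor]
    fun_prop
  have hbound : ∀ w, ‖R w - w‖ ≤ ς / 2 := by
    intro w
    rw [hR _ w (hmem w), Real.norm_eq_abs, abs_le]
    constructor <;> linarith [(hmem w).1, (hmem w).2]
  have hfint : Integrable f := by
    refine ⟨hfc.aestronglyMeasurable, ?_⟩
    rw [hasFiniteIntegral_iff_ofReal (.of_forall hf_nonneg), ← setLIntegral_univ,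
      ← withDensity_apply _ MeasurableSet.univ, ← hlaw]
    have := Measure.isProbabilityMeasure_map (μ := μ) hz.aemeasurable
    exact measure_lt_top _ _
  have herr : Integrable fun w => (R w - w) * f w :=
    hfint.bdd_mul (hRm.sub measurable_id).aestronglyMeasurable (.of_forall hbound)
  have hmean : ∫ ω, (R (z ω) - z ω) ∂μ = ∫ w, (R w - w) * f w := by
    rw [← integral_map (f := fun w => R w - w) hz.aemeasurable
      (hRm.sub measurable_id).aestronglyMeasurable, hlaw,
      integral_withDensity_eq_integral_toReal_smul (by fun_prop) (by simp)]
    refine integral_congr_ae (.of_forall fun w => ?_)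
    simp [ENNReal.toReal_ofReal (hf_nonneg w), mul_comm]
  let cell : ℤ → Set ℝ := fun n => Set.Ico (ς * n - ς / 2) (ς * n + ς / 2)
  have hcell : ∀ n, cell n = Set.Ico (-(ς / 2) + n • ς) (-(ς / 2) + (n + 1) • ς) := by
    intro n
    simp only [cell, zsmul_eq_mul]
    push_cast
    congr 1 <;> ring
  have hdisj : Pairwise (Function.onFun Disjoint cell) := by
    rw [funext hcell]
    exact Set.pairwise_disjoint_Ico_add_zsmul _ _
  have hcover : ⋃ n, cell n = Set.univ :=
    Set.eq_univ_of_forall fun w => Set.mem_iUnion.2 ⟨_, hmem w⟩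
  have hcellm : ∀ n, MeasurableSet (cell n) := fun _ => measurableSet_Ico
  have hsum := hasSum_integral_iUnion hcellm hdisj herr.integrableOn
  have hsum' := hasSum_integral_iUnion hcellm hdisj hf'.abs.integrableOn
  rw [hcover, setIntegral_univ] at hsum hsum'
  rw [hmean, ← hsum.tsum_eq, ← Real.norm_eq_abs]
  refine tsum_of_norm_bounded (hsum'.mul_left (ς ^ 2 / 8)) fun n => ?_
  have hcongr : ∫ w in cell n, (R w - w) * f w = ∫ w in cell n, (ς * n - w) * f w :=
    setIntegral_congr_fun (hcellm n) fun w hw => by simp only [hR n w hw]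
  rw [hcongr, Real.norm_eq_abs]
  exact abs_setIntegral_Ico_center_sub_mul_le hf_smooth hς (ς * n)
end
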